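/- Let 0 < s < 1 and let φ ∈ C_c^∞(ℝ²). The commutator operator T_φ defined by (T_φ w)(x) = C_s ∫_{ℝ²} (φ(x) − φ(y)) w(y) / |x−y|^{2+s} dy is a bounded linear operator from L²_uloc(ℝ²) to L²_uloc(ℝ²). -/

import Mathlib

open MeasureTheory Real Set
open scoped ENNReal FourierTransform

noncomputable section

abbrev E2 := EuclideanSpace ℝ (Fin 2)

/-- The unit cube with corner at the lattice point `k`. -/
def cube (k : Fin 2 → ℤ) : Set E2 := {x | ∀ i, (k i : ℝ) ≤ x i ∧ x i ≤ (k i : ℝ) + 1}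

/-- Squared uniformly-local `L²` norm. -/
def uloc2 (w : E2 → ℝ) : ℝ≥0∞ := ⨆ k : Fin 2 → ℤ, ∫⁻ x in cube k, ENNReal.ofReal (w x ^ 2)

def kerA (K s : ℝ) (z : E2) : ℝ := K * (min 1 ‖z‖ / ‖z‖ ^ (2 + s))

lemma kerA_meas (K s : ℝ) : Measurable (kerA K s) := by
  unfold kerA
  fun_prop

lemma kerA_integrable (K s : ℝ) (hs : 0 < s) (hs1 : s < 1) : Integrable (kerA K s) := by
  unfold kerA
  refine Integrable.const_mul ?_ K
  rw [integrable_fun_norm_addHaar (volume : Measure E2)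
    (f := fun r : ℝ => min 1 r / r ^ (2 + s))]
  have hd : Module.finrank ℝ E2 - 1 = 1 := by simp
  rw [hd, ← Ioc_union_Ioi_eq_Ioi (zero_le_one' ℝ)]
  refine IntegrableOn.union ?_ ?_
  · have h1 : IntegrableOn (fun r : ℝ => r ^ (-s)) (Ioc 0 1) := by
      rw [← intervalIntegrable_iff_integrableOn_Ioc_of_le zero_le_one]
      exact intervalIntegral.intervalIntegrable_rpow' (by linarith)
    refine h1.congr_fun ?_ measurableSet_Ioc
    intro r hr
    have hr0 : 0 < r := hr.1
    simp only [pow_one, smul_eq_mul, min_eq_right hr.2]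
    rw [show (2 : ℝ) + s = 1 + 1 + s by ring, rpow_add hr0, rpow_add hr0, rpow_one, rpow_neg hr0.le]
    have := (rpow_pos_of_pos hr0 s).ne'
    field_simp
  · have h1 : IntegrableOn (fun r : ℝ => r ^ (-1 - s)) (Ioi 1) :=
      integrableOn_Ioi_rpow_of_lt (by linarith) one_pos
    refine h1.congr_fun ?_ measurableSet_Ioi
    intro r hr
    have hr1 : 1 < r := hr
    have hr0 : 0 < r := by linarith
    simp only [pow_one, smul_eq_mul, min_eq_left hr1.le]
    rw [show (2 : ℝ) + s = 1 + 1 + s by ring, rpow_add hr0, rpow_add hr0, rpow_one,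
      sub_eq_add_neg, rpow_add hr0, rpow_neg hr0.le, rpow_neg hr0.le, rpow_one]
    have := (rpow_pos_of_pos hr0 s).ne'
    field_simp

lemma exists_K (φ : E2 → ℝ) (hφ : ContDiff ℝ (⊤ : ℕ∞) φ) (hφc : HasCompactSupport φ) :
    ∃ K : ℝ, 0 ≤ K ∧ ∀ x y, |φ x - φ y| ≤ K * min 1 ‖x - y‖ := by
  obtain ⟨L, hL⟩ := ContDiff.lipschitzWith_of_hasCompactSupport hφc hφ (by simp)
  obtain ⟨M, hM⟩ := hφc.exists_bound_of_continuous hφ.continuous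
  have hM0 : 0 ≤ M := (norm_nonneg _).trans (hM 0)
  refine ⟨2 * M + L, by positivity, fun x y => ?_⟩
  have h1 : |φ x - φ y| ≤ 2 * M := by
    have := hM x
    have := hM y
    have := norm_sub_le (φ x) (φ y)
    rw [← Real.norm_eq_abs]
    linarith
  have h2 : |φ x - φ y| ≤ L * ‖x - y‖ := by
    simpa [dist_eq_norm] using hL.dist_le_mul x y
  have hL0 : (0 : ℝ) ≤ L := L.2
  rcases le_total 1 ‖x - y‖ with h | h
  · rw [min_eq_left h]; linarith
  · rw [min_eq_right h]
    have := norm_nonneg (x - y)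
    nlinarith

lemma lintegral_sq_le (A f : E2 → ℝ≥0∞) (hA : Measurable A) (hf : Measurable f) :
    (∫⁻ z, A z * f z) ^ 2 ≤ (∫⁻ z, A z) * ∫⁻ z, A z * f z ^ 2 := by
  have h := ENNReal.lintegral_mul_le_Lp_mul_Lq (volume : Measure E2) Real.HolderConjugate.two_two
    (f := fun z => A z ^ (1 / 2 : ℝ)) (g := fun z => A z ^ (1 / 2 : ℝ) * f z)
    (by fun_prop) (by fun_prop)
  have e1 : ∀ a : ℝ≥0∞, a ^ (1 / 2 : ℝ) * a ^ (1 / 2 : ℝ) = a := by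
    intro a
    rw [← ENNReal.rpow_add_of_nonneg _ _ (by norm_num) (by norm_num)]
    norm_num
  have e2 : ∀ a : ℝ≥0∞, (a ^ (1 / 2 : ℝ)) ^ 2 = a := by
    intro a
    rw [sq, e1]
  simp only [Pi.mul_apply, ← mul_assoc, e1, ENNReal.rpow_two, mul_pow, e2] at h
  calc _ ≤ _ := pow_le_pow_left' h 2
    _ = _ := by rw [mul_pow, e2, e2]

lemma cube_meas (k : Fin 2 → ℤ) : MeasurableSet (cube k) := by
  have : cube k = ⋂ i, {x : E2 | (k i : ℝ) ≤ x i ∧ x i ≤ (k i : ℝ) + 1} := by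
    ext x; simp [cube]
  rw [this]
  refine MeasurableSet.iInter fun i => ?_
  have hm : Measurable (fun x : E2 => x i) := by fun_prop
  exact (measurableSet_le measurable_const hm).inter (measurableSet_le hm measurable_const)

lemma cube_shift (g : E2 → ℝ≥0∞) (hg : Measurable g) (S : ℝ≥0∞)
    (hS : ∀ k, ∫⁻ x in cube k, g x ≤ S) (k : Fin 2 → ℤ) (z : E2) :
    ∫⁻ x in cube k, g (x - z) ≤ 4 * S := by
  have h1 : ∫⁻ x in cube k, g (x - z) = ∫⁻ y in {y | y + z ∈ cube k}, g y := by
    have hm : MeasurableSet {y | y + z ∈ cube k} :=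
      (cube_meas k).preimage (measurable_add_const z)
    rw [← lintegral_indicator (cube_meas k), ← lintegral_indicator hm,
      ← lintegral_add_right_eq_self _ z]
    congr 1
    ext y
    by_cases hy : y + z ∈ cube k
    · simp [indicator, hy]
    · simp [indicator, hy]
  rw [h1]
  have hsub : {y | y + z ∈ cube k} ⊆
      ⋃ e : Fin 2 → Fin 2, cube (fun i => ⌊(k i : ℝ) - z i⌋ + ((e i : ℕ) : ℤ)) := by
    intro y hy
    have hy' : ∀ i, (k i : ℝ) ≤ y i + z i ∧ y i + z i ≤ (k i : ℝ) + 1 := hy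
    have hex : ∀ i, ∃ e : Fin 2, ((⌊(k i : ℝ) - z i⌋ + ((e : ℕ) : ℤ) : ℤ) : ℝ) ≤ y i ∧
        y i ≤ ((⌊(k i : ℝ) - z i⌋ + ((e : ℕ) : ℤ) : ℤ) : ℝ) + 1 := by
      intro i
      have f1 := Int.floor_le ((k i : ℝ) - z i)
      have f2 := Int.lt_floor_add_one ((k i : ℝ) - z i)
      obtain ⟨a, b⟩ := hy' i
      rcases le_total (y i) (⌊(k i : ℝ) - z i⌋ + 1 : ℝ) with h | h
      · refine ⟨0, ?_, ?_⟩ <;> push_cast <;> simp <;> linarith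
      · refine ⟨1, ?_, ?_⟩ <;> push_cast <;> simp <;> linarith
    choose e he using hex
    exact mem_iUnion.2 ⟨e, he⟩
  calc _ ≤ ∫⁻ y in ⋃ e : Fin 2 → Fin 2,
        cube (fun i => ⌊(k i : ℝ) - z i⌋ + ((e i : ℕ) : ℤ)), g y := lintegral_mono_set hsub
    _ ≤ ∑' e : Fin 2 → Fin 2, ∫⁻ y in
        cube (fun i => ⌊(k i : ℝ) - z i⌋ + ((e i : ℕ) : ℤ)), g y := lintegral_iUnion_le _ _
    _ ≤ ∑' e : Fin 2 → Fin 2, S := ENNReal.tsum_le_tsum fun e => hS _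
    _ = 4 * S := by simp [tsum_fintype]

lemma young_cube (A f : E2 → ℝ≥0∞) (hA : Measurable A) (hf : Measurable f) (S : ℝ≥0∞)
    (hS : ∀ k, ∫⁻ x in cube k, f x ^ 2 ≤ S) (k : Fin 2 → ℤ) :
    ∫⁻ x in cube k, (∫⁻ y, A (x - y) * f y) ^ 2 ≤ 4 * (∫⁻ z, A z) ^ 2 * S := by
  have h1 : ∀ x, ∫⁻ y, A (x - y) * f y = ∫⁻ z, A z * f (x - z) := by
    intro x
    rw [← lintegral_sub_left_eq_self (fun y => A (x - y) * f y) x]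
    simp
  calc _ ≤ ∫⁻ x in cube k, (∫⁻ z, A z) * ∫⁻ z, A z * f (x - z) ^ 2 := by
        refine lintegral_mono fun x => ?_
        rw [h1]
        exact lintegral_sq_le A (fun z => f (x - z)) hA (by fun_prop)
    _ = (∫⁻ z, A z) * ∫⁻ x in cube k, ∫⁻ z, A z * f (x - z) ^ 2 := by
        refine lintegral_const_mul _ ?_
        exact Measurable.lintegral_prod_right' (f := fun p : E2 × E2 => A p.2 * f (p.1 - p.2) ^ 2)
          (by fun_prop)
    _ = (∫⁻ z, A z) * ∫⁻ z, ∫⁻ x in cube k, A z * f (x - z) ^ 2 := by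
        rw [lintegral_lintegral_swap]
        exact Measurable.aemeasurable (by fun_prop)
    _ = (∫⁻ z, A z) * ∫⁻ z, A z * ∫⁻ x in cube k, f (x - z) ^ 2 := by
        congr 2
        ext z
        exact lintegral_const_mul _ (by fun_prop)
    _ ≤ (∫⁻ z, A z) * ∫⁻ z, A z * (4 * S) := by
        gcongr with z
        exact cube_shift (fun x => f x ^ 2) (by fun_prop) S hS k z
    _ = _ := by
        rw [lintegral_mul_const _ hA]
        ring

lemma ofReal_sq_eq (a : ℝ) : ENNReal.ofReal (a ^ 2) = ‖a‖ₑ ^ 2 := by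
  rw [← enorm_pow, Real.enorm_of_nonneg (sq_nonneg a)]

/-- The commutator `T_φ w = C_s ∫ (φ(x)−φ(y)) w(y)/|x−y|^{2+s} dy` is bounded from
`L²_uloc` to `L²_uloc`. -/
theorem stmt3 (s Cs : ℝ) (hs : 0 < s) (hs1 : s < 1)
    (φ : E2 → ℝ) (hφ : ContDiff ℝ (⊤ : ℕ∞) φ) (hφc : HasCompactSupport φ) :
    ∃ C : ℝ≥0∞, C ≠ ⊤ ∧ ∀ w : E2 → ℝ, Measurable w → uloc2 w < ⊤ →
      (∀ᵐ x : E2, Integrable (fun y => (φ x - φ y) * w y / ‖x - y‖ ^ (2 + s))) ∧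
      uloc2 (fun x => Cs * ∫ y, (φ x - φ y) * w y / ‖x - y‖ ^ (2 + s))
        ≤ C * uloc2 w := by
  obtain ⟨K, hK0, hK⟩ := exists_K φ hφ hφc
  set A : E2 → ℝ≥0∞ := fun z => ENNReal.ofReal (kerA K s z) with hAdef
  have hA : Measurable A := (kerA_meas K s).ennreal_ofReal
  have hAfin : ∫⁻ z, A z ≠ ⊤ := (kerA_integrable K s hs hs1).lintegral_lt_top.ne
  refine ⟨‖Cs‖ₑ ^ 2 * (4 * (∫⁻ z, A z) ^ 2), ?_, fun w hw hwfin => ?_⟩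
  · exact ENNReal.mul_ne_top (by simp) (ENNReal.mul_ne_top (by simp) (by simp [hAfin]))
  have hpt : ∀ x y, ‖(φ x - φ y) * w y / ‖x - y‖ ^ (2 + s)‖ₑ ≤ A (x - y) * ‖w y‖ₑ := by
    intro x y
    have hr : 0 ≤ ‖x - y‖ ^ (2 + s) := by positivity
    rw [mul_div_right_comm, enorm_mul]
    gcongr
    rw [← ofReal_norm]
    refine ENNReal.ofReal_le_ofReal ?_
    rw [norm_div, Real.norm_eq_abs, Real.norm_of_nonneg hr, kerA, ← mul_div_assoc]
    gcongr
    exact hK x y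
  have hS : ∀ k, ∫⁻ x in cube k, ‖w x‖ₑ ^ 2 ≤ uloc2 w := by
    intro k
    simp only [uloc2, ofReal_sq_eq]
    exact le_iSup (fun k => ∫⁻ x in cube k, ‖w x‖ₑ ^ 2) k
  have hY := young_cube A (fun y => ‖w y‖ₑ) hA (by fun_prop) (uloc2 w) hS
  have hφm : Measurable φ := hφ.continuous.measurable
  have hFm : Measurable (fun x => (∫⁻ y, A (x - y) * ‖w y‖ₑ) ^ 2) := by
    refine Measurable.pow_const ?_ 2
    exact Measurable.lintegral_prod_right' (f := fun p : E2 × E2 => A (p.1 - p.2) * ‖w p.2‖ₑ)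
      (by fun_prop)
  constructor
  · have hcov : (⋃ k, cube k) = univ := by
      refine eq_univ_of_forall fun x => mem_iUnion.2 ⟨fun i => ⌊x i⌋, fun i => ⟨Int.floor_le _, ?_⟩⟩
      exact (Int.lt_floor_add_one _).le
    rw [← Measure.restrict_univ (μ := (volume : Measure E2)), ← hcov, ae_restrict_iUnion_iff]
    intro k
    rw [hcov, Measure.restrict_univ]
    have hlt : ∫⁻ x in cube k, (∫⁻ y, A (x - y) * ‖w y‖ₑ) ^ 2 ≠ ⊤ :=
      ((hY k).trans_lt (ENNReal.mul_lt_top (ENNReal.mul_lt_top (by simp)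
        (by simp [hAfin.lt_top])) hwfin)).ne
    filter_upwards [ae_lt_top hFm hlt] with x hx
    refine ⟨Measurable.aestronglyMeasurable (by fun_prop), ?_⟩
    refine (lintegral_mono (hpt x)).trans_lt ?_
    by_contra hcon
    rw [not_lt, top_le_iff] at hcon
    simp [hcon] at hx
  · refine iSup_le fun k => ?_
    calc _ ≤ ∫⁻ x in cube k, ‖Cs‖ₑ ^ 2 * (∫⁻ y, A (x - y) * ‖w y‖ₑ) ^ 2 := by
          refine lintegral_mono fun x => ?_
          simp only [ofReal_sq_eq]
          rw [enorm_mul, mul_pow]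
          gcongr
          exact (enorm_integral_le_lintegral_enorm _).trans (lintegral_mono (hpt x))
      _ = ‖Cs‖ₑ ^ 2 * ∫⁻ x in cube k, (∫⁻ y, A (x - y) * ‖w y‖ₑ) ^ 2 :=
          lintegral_const_mul _ hFm
      _ ≤ ‖Cs‖ₑ ^ 2 * (4 * (∫⁻ z, A z) ^ 2 * uloc2 w) := by gcongr; exact hY k
      _ = _ := by ring
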